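/- Let p be a prime and G a nontrivial finite abelian p-group. Then the lattice of characteristic subgroups of G, ordered by inclusion, is directly indecomposable: there do not exist lattices α and β, each with at least two elements, together with an order isomorphism from the set of characteristic subgroups of G onto the product lattice α × β. -/

import Mathlib

/-- A subgroup is characteristic if it is mapped onto itself by every automorphism. -/
def IsCharSub {G : Type*} [AddGroup G] (H : AddSubgroup G) : Prop :=
  ∀ φ : AddAut G, AddSubgroup.map φ.toAddMonoidHom H = H

/-- Over `ZMod (p ^ (e + 1))`, every nonzero element divides `p ^ e`. -/
lemma ZMod.exists_mul_eq_prime_pow {p : ℕ} (hp : p.Prime) (e : ℕ) {r : ZMod (p ^ (e + 1))}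
    (hr : r ≠ 0) : ∃ s : ZMod (p ^ (e + 1)), s * r = (p : ZMod (p ^ (e + 1))) ^ e := by
  have : NeZero (p ^ (e + 1)) := ⟨pow_ne_zero _ hp.ne_zero⟩
  obtain ⟨n, rfl⟩ : ∃ n : ℕ, (n : ZMod (p ^ (e + 1))) = r := ⟨r.val, r.natCast_zmod_val⟩
  have hn : n ≠ 0 := by rintro rfl; simp at hr
  obtain ⟨j, m, hm, rfl⟩ := Nat.exists_eq_pow_mul_and_not_dvd hn p hp.ne_one
  have hj : j ≤ e := by
    by_contra! h
    exact hr ((ZMod.natCast_eq_zero_iff _ _).2 (Dvd.dvd.mul_right (pow_dvd_pow p h) m))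
  have hu := (ZMod.isUnit_natCast_iff_not_dvd_pow (a := m) hp e.succ_pos).2 hm
  obtain ⟨v, hv⟩ := hu.exists_left_inv
  refine ⟨(p : ZMod (p ^ (e + 1))) ^ (e - j) * v, ?_⟩
  calc _ = (p : ZMod (p ^ (e + 1))) ^ (e - j) * p ^ j * (v * m) := by push_cast; ring
    _ = _ := by rw [hv, mul_one, ← pow_add, Nat.sub_add_cancel hj]

/-- Over `ZMod (p ^ (e + 1))`, an element not annihilated by `p ^ e` is a unit. -/
lemma ZMod.isUnit_of_prime_pow_mul_ne_zero {p : ℕ} (hp : p.Prime) (e : ℕ)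
    {r : ZMod (p ^ (e + 1))} (hr : (p : ZMod (p ^ (e + 1))) ^ e * r ≠ 0) : IsUnit r := by
  have : NeZero (p ^ (e + 1)) := ⟨pow_ne_zero _ hp.ne_zero⟩
  obtain ⟨n, rfl⟩ : ∃ n : ℕ, (n : ZMod (p ^ (e + 1))) = r := ⟨r.val, r.natCast_zmod_val⟩
  refine (ZMod.isUnit_natCast_iff_not_dvd_pow hp e.succ_pos).2 fun ⟨m, hm⟩ ↦ hr ?_
  have : ((p ^ (e + 1) * m : ℕ) : ZMod (p ^ (e + 1))) = 0 :=
    (ZMod.natCast_eq_zero_iff _ _).2 (dvd_mul_right _ _)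
  rw [← this, hm]
  push_cast
  ring

/-- Homomorphisms from a finite abelian group to the integers modulo a multiple of its exponent
separate points. -/
lemma AddCommGroup.exists_zmod_apply_ne_zero {G : Type*} [AddCommGroup G] [Finite G] {N : ℕ}
    (hN : N ≠ 0) (hG : AddMonoid.exponent G ∣ N) {x : G} (hx : x ≠ 0) :
    ∃ χ : G →+ ZMod N, χ x ≠ 0 := by
  obtain ⟨ι, _, n, -, ⟨E⟩⟩ := CommGroup.equiv_prod_multiplicative_zmod_of_finite (Multiplicative G)
  obtain ⟨i, hi⟩ : ∃ i, E (.ofAdd x) i ≠ 1 := by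
    contrapose! hx
    exact (MulEquiv.map_eq_one_iff E).mp (funext hx)
  let ψ : G →+ ZMod (n i) :=
    AddMonoidHom.toMultiplicative.symm ((Pi.evalMonoidHom _ i).comp E.toMonoidHom)
  have hψx : ψ x ≠ 0 := hi
  have hψ : Function.Surjective ψ := (Function.surjective_eval i).comp E.surjective
  have hn : n i ∣ N := by
    obtain ⟨y, hy⟩ := hψ 1
    rw [← ZMod.natCast_eq_zero_iff, ← nsmul_one, ← hy, ← map_nsmul,
      AddMonoid.exponent_dvd_iff_forall_nsmul_eq_zero.1 hG, map_zero]
  clear_value ψ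
  generalize n i = n at ψ hψx hn
  obtain ⟨m, rfl⟩ := hn
  have hm : m ≠ 0 := right_ne_zero_of_mul hN
  let g : {f : ℤ →+ ZMod (n * m) // f n = 0} :=
    ⟨(AddMonoidHom.mulRight (m : ZMod (n * m))).comp (Int.castAddHom _), by
      simpa [-CharP.cast_eq_zero] using ZMod.natCast_self (n * m)⟩
  have hg : Function.Injective (ZMod.lift n g) := by
    rw [ZMod.lift_injective]
    intro k hk
    have h : ((k * m : ℤ) : ZMod (n * m)) = 0 := by simpa [g] using hk
    rw [ZMod.intCast_zmod_eq_zero_iff_dvd] at *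
    push_cast at h
    exact Int.dvd_of_mul_dvd_mul_right (by exact_mod_cast hm) h
  exact ⟨(ZMod.lift n g).comp ψ, fun h ↦ hψx (hg (by simpa using h))⟩

/-- The transvection `x ↦ x + f x • z`, for `f` a linear form vanishing at `z`. -/
def AddAut.transvection {R G : Type*} [Ring R] [AddCommGroup G] [Module R G] (f : G →ₗ[R] R)
    (z : G) (hz : f z = 0) : AddAut G where
  toFun x := x + f x • z
  invFun x := x - f x • z
  left_inv x := by simp [hz]
  right_inv x := by simp [hz]
  map_add' x y := by simp only [map_add, add_smul]; abel

lemma IsCharSub.apply_mem {G : Type*} [AddGroup G] {H : AddSubgroup G} (hH : IsCharSub H)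
    (φ : AddAut G) {x : G} (hx : x ∈ H) : φ x ∈ H := by
  rw [← hH φ]
  exact ⟨x, hx, rfl⟩

lemma isCharSub_bot {G : Type*} [AddGroup G] : IsCharSub (⊥ : AddSubgroup G) :=
  fun _ ↦ AddSubgroup.map_bot _

lemma IsCharSub.inf {G : Type*} [AddGroup G] {H K : AddSubgroup G} (hH : IsCharSub H)
    (hK : IsCharSub K) : IsCharSub (H ⊓ K) := fun φ ↦ by
  rw [AddSubgroup.map_inf _ _ _ φ.injective, hH φ, hK φ]

/-- A nontrivial finite abelian `p`-group has a nonzero element contained in every nonzero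
characteristic subgroup. -/
lemma exists_ne_zero_mem_of_isCharSub {p : ℕ} (hp : p.Prime) {G : Type*} [AddCommGroup G]
    [Finite G] [Nontrivial G] (hG : ∃ k : ℕ, Nat.card G = p ^ k) :
    ∃ w : G, w ≠ 0 ∧ ∀ H : AddSubgroup G, IsCharSub H → H ≠ ⊥ → w ∈ H := by
  obtain ⟨k, hk⟩ := hG
  obtain ⟨z, hz⟩ := AddMonoid.exists_addOrderOf_eq_exponent
    (AddMonoid.ExponentExists.of_finite (G := G))
  obtain ⟨e', -, he'⟩ := (Nat.dvd_prime_pow hp).1 (hk ▸ AddGroup.exponent_dvd_nat_card (G := G))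
  obtain ⟨e, rfl⟩ : ∃ e, e' = e + 1 := by
    refine Nat.exists_eq_succ_of_ne_zero ?_
    rintro rfl
    rw [pow_zero, AddMonoid.exp_eq_one_iff] at he'
    exact not_subsingleton G he'
  have hN : p ^ (e + 1) ≠ 0 := pow_ne_zero _ hp.ne_zero
  have : Module (ZMod (p ^ (e + 1))) G := AddCommGroup.zmodModule fun x ↦ by
    rw [← he']; exact AddMonoid.exponent_nsmul_eq_zero x
  have sep {x : G} (hx : x ≠ 0) : ∃ f : G →ₗ[ZMod (p ^ (e + 1))] ZMod (p ^ (e + 1)), f x ≠ 0 := by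
    obtain ⟨χ, hχ⟩ := AddCommGroup.exists_zmod_apply_ne_zero hN he'.dvd hx
    exact ⟨χ.toZModLinearMap _, hχ⟩
  have mem_smul (H : AddSubgroup G) (r : ZMod (p ^ (e + 1))) {x : G} (hx : x ∈ H) : r • x ∈ H :=
    ZMod.smul_mem hx r
  have hw : (p : ZMod (p ^ (e + 1))) ^ e • z ≠ 0 := by
    intro h
    have h' : p ^ e • z = 0 := by
      rw [← Nat.cast_smul_eq_nsmul (ZMod (p ^ (e + 1)))]; exact_mod_cast h
    have := addOrderOf_dvd_of_nsmul_eq_zero h'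
    rw [hz, he', Nat.pow_dvd_pow_iff_le_right hp.one_lt] at this
    omega
  have mem_of_smul {H : AddSubgroup G} {r : ZMod (p ^ (e + 1))} (hr : r ≠ 0) (h : r • z ∈ H) :
      (p : ZMod (p ^ (e + 1))) ^ e • z ∈ H := by
    obtain ⟨s, hs⟩ := ZMod.exists_mul_eq_prime_pow hp e hr
    rw [← hs, mul_smul]
    exact mem_smul H s h
  obtain ⟨f, hf⟩ := sep hw
  rw [map_smul, smul_eq_mul] at hf
  obtain ⟨v, hv⟩ := (ZMod.isUnit_of_prime_pow_mul_ne_zero hp e hf).exists_left_inv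
  refine ⟨_, hw, fun H hH hbot ↦ ?_⟩
  obtain ⟨x, hxH, hx⟩ := (AddSubgroup.bot_or_exists_ne_zero H).resolve_left hbot
  by_cases hk : x - (v * f x) • z = 0
  · rw [sub_eq_zero] at hk
    refine mem_of_smul (r := v * f x) (fun h ↦ hx ?_) (hk ▸ hxH)
    rw [hk, h, zero_smul]
  · obtain ⟨g, hg⟩ := sep hk
    let h : G →ₗ[ZMod (p ^ (e + 1))] ZMod (p ^ (e + 1)) := g - (g z * v) • f
    have hhz : h z = 0 := by simp [h, mul_assoc, hv]
    have hhx : h x ≠ 0 := by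
      convert hg using 1
      simp [h]
      ring
    have := H.sub_mem (hH.apply_mem (AddAut.transvection h z hhz) hxH) hxH
    refine mem_of_smul hhx ?_
    simpa [AddAut.transvection] using this

theorem stmt_18 (p : ℕ) (hp : p.Prime) (G : Type*) [AddCommGroup G] [Finite G]
    [Nontrivial G] (hG : ∃ k : ℕ, Nat.card G = p ^ k) :
    ∀ (α β : Type) [Lattice α] [Lattice β], Nontrivial α → Nontrivial β →
      IsEmpty ({H : AddSubgroup G // IsCharSub H} ≃o (α × β)) := by
  refine fun α β _ _ _ _ ↦ ⟨fun e ↦ ?_⟩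
  obtain ⟨w, hw, hmem⟩ := exists_ne_zero_mem_of_isCharSub hp hG
  let B : {H : AddSubgroup G // IsCharSub H} := ⟨⊥, isCharSub_bot⟩
  have ne_bot {y : α × β} (hy : y ≠ e B) : (e.symm y).1 ≠ ⊥ := fun h ↦
    hy (by rw [← e.apply_symm_apply y]; exact congrArg e (Subtype.ext h))
  obtain ⟨a, ha⟩ := exists_ne (e B).1
  obtain ⟨b, hb⟩ := exists_ne (e B).2
  let H := e.symm (a, (e B).2)
  let K := e.symm ((e B).1, b)
  have hwH : w ∈ H.1 := hmem _ H.2 (ne_bot fun h ↦ ha (congrArg Prod.fst h))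
  have hwK : w ∈ K.1 := hmem _ K.2 (ne_bot fun h ↦ hb (congrArg Prod.snd h))
  let M : {H : AddSubgroup G // IsCharSub H} := ⟨H.1 ⊓ K.1, H.2.inf K.2⟩
  have hMH : e M ≤ (a, (e B).2) := e.le_symm_apply.1 (show M.1 ≤ H.1 from inf_le_left)
  have hMK : e M ≤ ((e B).1, b) := e.le_symm_apply.1 (show M.1 ≤ K.1 from inf_le_right)
  have hMB : M ≤ B := e.le_iff_le.1 ⟨hMK.1, hMH.2⟩
  exact hw (AddSubgroup.mem_bot.1 (hMB (show w ∈ M.1 from ⟨hwH, hwK⟩)))
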